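/- For every λ, μ ∈ ℂ and every spin s with 2s ∈ ℤ_{>0}, the Lax operator satisfies the Yang–Baxter equation R₁₂(λ−μ) L^{(1/2,s)}₁₃(λ) L^{(1/2,s)}₂₃(μ) = L^{(1/2,s)}₂₃(μ) L^{(1/2,s)}₁₃(λ) R₁₂(λ−μ) as operators on ℂ² ⊗ ℂ² ⊗ ℂ^{2s+1}, where the subscripts indicate on which tensor factors each operator acts (identity on the remaining factor). -/

import Mathlib

open Matrix BigOperators Finset

noncomputable section

namespace AntiperiodicXXX

/-- `S^z` for the spin-`s` representation with `2s = m`, acting on `ℂ^{m+1}`: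
`S^z = diag(s, s-1, …, -s)`. -/
def Sz (m : ℕ) : Matrix (Fin (m + 1)) (Fin (m + 1)) ℂ :=
  Matrix.diagonal fun i => (m : ℂ) / 2 - (i : ℕ)

/-- `S^+` for spin `s = m/2`: superdiagonal entries `x(j) = √(j(2s+1−j))`. -/
def Splus (m : ℕ) : Matrix (Fin (m + 1)) (Fin (m + 1)) ℂ :=
  Matrix.of fun i j =>
    if (i : ℕ) + 1 = (j : ℕ) then
      ((Real.sqrt (((i : ℕ) + 1) * (m - (i : ℕ))) : ℝ) : ℂ)
    else 0

/-- `S^- = (S^+)^T`. -/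
def Sminus (m : ℕ) : Matrix (Fin (m + 1)) (Fin (m + 1)) ℂ := (Splus m)ᵀ

/-- The Lax operator `L^{(1/2,s)}(λ)` on `ℂ² ⊗ ℂ^{m+1}` in 2×2 block form
`[[λ+η(1/2+S^z), ηS^-], [ηS^+, λ+η(1/2−S^z)]]`. -/
def Lax (η : ℂ) (m : ℕ) (lam : ℂ) :
    Matrix (Fin 2 × Fin (m + 1)) (Fin 2 × Fin (m + 1)) ℂ :=
  Matrix.of fun p q =>
    (![![(lam + η / 2) • (1 : Matrix (Fin (m + 1)) (Fin (m + 1)) ℂ) + η • Sz m,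
        η • Sminus m],
       ![η • Splus m,
        (lam + η / 2) • (1 : Matrix (Fin (m + 1)) (Fin (m + 1)) ℂ) - η • Sz m]]
      p.1 q.1) p.2 q.2

/-- The rational 6-vertex R-matrix `[[λ+η,0,0,0],[0,λ,η,0],[0,η,λ,0],[0,0,0,λ+η]]`
on `ℂ² ⊗ ℂ²`. -/
def Rmat (η lam : ℂ) : Matrix (Fin 2 × Fin 2) (Fin 2 × Fin 2) ℂ :=
  Matrix.of fun p q =>
    if p = q then (if p.1 = p.2 then lam + η else lam)
    else if p.1 = q.2 ∧ p.2 = q.1 ∧ p.1 ≠ p.2 then η else 0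

variable {N : ℕ}

/-- Index type of the quantum space `H = ⊗_{n=1}^N ℂ^{2s_n+1}` (with `m n = 2s_n`). -/
abbrev HIdx (m : Fin N → ℕ) := (n : Fin N) → Fin (m n + 1)

/-- The Lax operator `L^{(1/2,s_n)}_{0n}(λ−η_n)` at site `n` acting on `ℂ² ⊗ H`
(identity on the other tensor factors of `H`). -/
def siteL (η : ℂ) (m : Fin N → ℕ) (inh : Fin N → ℂ) (lam : ℂ) (n : Fin N) :
    Matrix (Fin 2 × HIdx m) (Fin 2 × HIdx m) ℂ :=
  Matrix.of fun p q =>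
    Lax η (m n) (lam - inh n) (p.1, p.2 n) (q.1, q.2 n) *
      (if ∀ k, k ≠ n → p.2 k = q.2 k then 1 else 0)

/-- The monodromy matrix `M₀(λ) = L_{0N}(λ−η_N) ⋯ L_{01}(λ−η₁)` on `ℂ² ⊗ H`. -/
def Mono (η : ℂ) (m : Fin N → ℕ) (inh : Fin N → ℂ) (lam : ℂ) :
    Matrix (Fin 2 × HIdx m) (Fin 2 × HIdx m) ℂ :=
  ((List.ofFn fun n : Fin N => siteL η m inh lam n).reverse).prod

/-- `A(λ)`: entry `(0,0)` of the monodromy matrix. -/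
def EntA (η : ℂ) (m : Fin N → ℕ) (inh : Fin N → ℂ) (lam : ℂ) :
    Matrix (HIdx m) (HIdx m) ℂ :=
  Matrix.of fun f g => Mono η m inh lam (0, f) (0, g)

/-- `B(λ)`: entry `(0,1)` of the monodromy matrix. -/
def EntB (η : ℂ) (m : Fin N → ℕ) (inh : Fin N → ℂ) (lam : ℂ) :
    Matrix (HIdx m) (HIdx m) ℂ :=
  Matrix.of fun f g => Mono η m inh lam (0, f) (1, g)

/-- `C(λ)`: entry `(1,0)` of the monodromy matrix. -/
def EntC (η : ℂ) (m : Fin N → ℕ) (inh : Fin N → ℂ) (lam : ℂ) :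
    Matrix (HIdx m) (HIdx m) ℂ :=
  Matrix.of fun f g => Mono η m inh lam (1, f) (0, g)

/-- `D(λ)`: entry `(1,1)` of the monodromy matrix. -/
def EntD (η : ℂ) (m : Fin N → ℕ) (inh : Fin N → ℂ) (lam : ℂ) :
    Matrix (HIdx m) (HIdx m) ℂ :=
  Matrix.of fun f g => Mono η m inh lam (1, f) (1, g)

/-- The antiperiodic transfer matrix `T̄(λ) = B(λ) + C(λ)`. -/
def Tbar (η : ℂ) (m : Fin N → ℕ) (inh : Fin N → ℂ) (lam : ℂ) :
    Matrix (HIdx m) (HIdx m) ℂ :=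
  EntB η m inh lam + EntC η m inh lam

/-- `a(λ) = −∏_{n=1}^N (λ − η_n^− + s_n η)`, with `η_n^− = η_n − η/2`. -/
def af (η : ℂ) (m : Fin N → ℕ) (inh : Fin N → ℂ) (lam : ℂ) : ℂ :=
  -∏ n, (lam - (inh n - η / 2) + (m n : ℂ) / 2 * η)

/-- `d(λ) = ∏_{n=1}^N (λ − η_n^− − s_n η)`. -/
def df (η : ℂ) (m : Fin N → ℕ) (inh : Fin N → ℂ) (lam : ℂ) : ℂ :=
  ∏ n, (lam - (inh n - η / 2) - (m n : ℂ) / 2 * η)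

/-- `η_n^{(k)} = η_n^− + (s_n − k)η`. -/
def etaK (η : ℂ) (m : Fin N → ℕ) (inh : Fin N → ℂ) (n : Fin N) (k : ℕ) : ℂ :=
  (inh n - η / 2) + ((m n : ℂ) / 2 - (k : ℂ)) * η

/-- The reference state `|0⟩ = ⊗_n (1,0,…,0)^T` (the same components give `⟨0|`). -/
def vac (m : Fin N → ℕ) : HIdx m → ℂ :=
  fun f => if ∀ n, f n = (0 : Fin (m n + 1)) then 1 else 0

/-- The Vandermonde-type coefficient `∏_{1≤b<a≤N} (η_a^{(h_a)} − η_b^{(h_b)})`. -/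
def vdm (η : ℂ) (m : Fin N → ℕ) (inh : Fin N → ℂ) (h : HIdx m) : ℂ :=
  ∏ a, ∏ b ∈ Finset.Iio a, (etaK η m inh a (h a) - etaK η m inh b (h b))

/-- The normalization `𝓃 = ∏_{1≤b<a≤N} (η_a^{(0)} − η_b^{(0)})^{1/2}`. -/
def nrm (η : ℂ) (m : Fin N → ℕ) (inh : Fin N → ℂ) : ℂ :=
  ∏ a, ∏ b ∈ Finset.Iio a, (etaK η m inh a 0 - etaK η m inh b 0) ^ ((1 : ℂ) / 2)

/-- The operator `∏_{n=1}^N ∏_{k_n=0}^{h_n−1} C(η_n^{(k_n)})/d(η_n^{(k_n+1)})`. -/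
def leftOp (η : ℂ) (m : Fin N → ℕ) (inh : Fin N → ℂ) (h : HIdx m) :
    Matrix (HIdx m) (HIdx m) ℂ :=
  (List.ofFn fun n : Fin N =>
    (List.ofFn fun k : Fin (h n : ℕ) =>
      (df η m inh (etaK η m inh n ((k : ℕ) + 1)))⁻¹ •
        EntC η m inh (etaK η m inh n (k : ℕ))).prod).prod

/-- The left SOV covector
`⟨h| = (1/𝓃) ⟨0| ∏_{n=1}^N ∏_{k_n=0}^{h_n−1} C(η_n^{(k_n)})/d(η_n^{(k_n+1)})`. -/
def lvec (η : ℂ) (m : Fin N → ℕ) (inh : Fin N → ℂ) (h : HIdx m) : HIdx m → ℂ :=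
  (nrm η m inh)⁻¹ • Matrix.vecMul (vac m) (leftOp η m inh h)

/-- The operator `∏_{n=1}^N ∏_{k_n=0}^{h_n−1} B(η_n^{(k_n)})/a(η_n^{(k_n)})`. -/
def rightOp (η : ℂ) (m : Fin N → ℕ) (inh : Fin N → ℂ) (h : HIdx m) :
    Matrix (HIdx m) (HIdx m) ℂ :=
  (List.ofFn fun n : Fin N =>
    (List.ofFn fun k : Fin (h n : ℕ) =>
      (af η m inh (etaK η m inh n (k : ℕ)))⁻¹ •
        EntB η m inh (etaK η m inh n (k : ℕ))).prod).prod

/-- The right SOV vector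
`|h⟩ = (1/𝓃) ∏_{n=1}^N ∏_{k_n=0}^{h_n−1} [B(η_n^{(k_n)})/a(η_n^{(k_n)})] |0⟩`. -/
def rvec (η : ℂ) (m : Fin N → ℕ) (inh : Fin N → ℂ) (h : HIdx m) : HIdx m → ℂ :=
  (nrm η m inh)⁻¹ • Matrix.mulVec (rightOp η m inh h) (vac m)

/-- `x + 1`, clamped inside `Fin (d+1)` (the clamped value only ever appears
multiplied by a vanishing coefficient). -/
def upIdx {d : ℕ} (x : Fin (d + 1)) : Fin (d + 1) :=
  if h : (x : ℕ) + 1 ≤ d then ⟨(x : ℕ) + 1, Nat.lt_succ_of_le h⟩ else x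

/-- `x − 1`, clamped inside `Fin (d+1)`. -/
def downIdx {d : ℕ} (x : Fin (d + 1)) : Fin (d + 1) :=
  ⟨(x : ℕ) - 1, lt_of_le_of_lt (Nat.sub_le _ _) x.isLt⟩

/-- `T_a^+(h) = (h₁,…,h_a+1,…,h_N)`. -/
def Tup (m : Fin N → ℕ) (h : HIdx m) (a : Fin N) : HIdx m :=
  Function.update h a (upIdx (h a))

/-- `T_a^-(h) = (h₁,…,h_a−1,…,h_N)`. -/
def Tdown (m : Fin N → ℕ) (h : HIdx m) (a : Fin N) : HIdx m :=
  Function.update h a (downIdx (h a))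

/-- The Pauli matrix `σ^x`. -/
def sigmaX : Matrix (Fin 2) (Fin 2) ℂ := !![0, 1; 1, 0]

/-- `Σ^x`: the `(m+1)×(m+1)` matrix with ones on the antidiagonal. -/
def SigX (m : ℕ) : Matrix (Fin (m + 1)) (Fin (m + 1)) ℂ :=
  Matrix.of fun i j => if (i : ℕ) + (j : ℕ) = m then 1 else 0

/-- `σ^x ⊗ Σ^x` on `ℂ² ⊗ ℂ^{m+1}`. -/
def flip1 (m : ℕ) : Matrix (Fin 2 × Fin (m + 1)) (Fin 2 × Fin (m + 1)) ℂ :=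
  Matrix.of fun p q => sigmaX p.1 q.1 * SigX m p.2 q.2

/-- `σ^x₀ ⊗ Σ^x` on `ℂ² ⊗ H`, with `Σ^x = ⊗_{a=1}^N Σ^x_a`. -/
def bigFlip (m : Fin N → ℕ) : Matrix (Fin 2 × HIdx m) (Fin 2 × HIdx m) ℂ :=
  Matrix.of fun p q => sigmaX p.1 q.1 * ∏ n, SigX (m n) (p.2 n) (q.2 n)

/-- The tridiagonal matrix `D_n(t)` with diagonal `t(η_n^{(i)})`, superdiagonal
`−a(η_n^{(i)})` and subdiagonal `−d(η_n^{(i)})`. -/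
def Dmat (η : ℂ) (m : Fin N → ℕ) (inh : Fin N → ℂ) (t : ℂ → ℂ) (n : Fin N) :
    Matrix (Fin (m n + 1)) (Fin (m n + 1)) ℂ :=
  Matrix.of fun i j =>
    if (i : ℕ) = (j : ℕ) then t (etaK η m inh n i)
    else if (i : ℕ) + 1 = (j : ℕ) then -af η m inh (etaK η m inh n i)
    else if (j : ℕ) + 1 = (i : ℕ) then -df η m inh (etaK η m inh n i)
    else 0

/-- The local lowering operator `S_n^-` acting on the `n`-th factor of `H`. -/
def SnMinus (m : Fin N → ℕ) (n : Fin N) : Matrix (HIdx m) (HIdx m) ℂ :=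
  Matrix.of fun f g =>
    Sminus (m n) (f n) (g n) * (if ∀ k, k ≠ n → f k = g k then 1 else 0)

/-- `η̄_n^{(x)} = η_n + (x − s_n − 1/2)η` for (half-integer) `x`. -/
def etaBar (η : ℂ) (m : Fin N → ℕ) (inh : Fin N → ℂ) (n : Fin N) (x : ℂ) : ℂ :=
  inh n + (x - (m n : ℂ) / 2 - 1 / 2) * η


/-- `R₁₂(λ−μ)` acting on factors 1,2 of `ℂ² ⊗ ℂ² ⊗ ℂ^{m+1}`. -/
def R12L (η lam : ℂ) (m : ℕ) :
    Matrix (Fin 2 × Fin 2 × Fin (m + 1)) (Fin 2 × Fin 2 × Fin (m + 1)) ℂ :=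
  Matrix.of fun p q =>
    Rmat η lam (p.1, p.2.1) (q.1, q.2.1) * (if p.2.2 = q.2.2 then 1 else 0)

/-- `L^{(1/2,s)}₁₃(λ)` acting on factors 1,3 of `ℂ² ⊗ ℂ² ⊗ ℂ^{m+1}`. -/
def L13 (η : ℂ) (m : ℕ) (lam : ℂ) :
    Matrix (Fin 2 × Fin 2 × Fin (m + 1)) (Fin 2 × Fin 2 × Fin (m + 1)) ℂ :=
  Matrix.of fun p q =>
    Lax η m lam (p.1, p.2.2) (q.1, q.2.2) * (if p.2.1 = q.2.1 then 1 else 0)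

/-- `L^{(1/2,s)}₂₃(λ)` acting on factors 2,3 of `ℂ² ⊗ ℂ² ⊗ ℂ^{m+1}`. -/
def L23 (η : ℂ) (m : ℕ) (lam : ℂ) :
    Matrix (Fin 2 × Fin 2 × Fin (m + 1)) (Fin 2 × Fin 2 × Fin (m + 1)) ℂ :=
  Matrix.of fun p q =>
    Lax η m lam (p.2.1, p.2.2) (q.2.1, q.2.2) * (if p.1 = q.1 then 1 else 0)

/-- `S^z S^+ - S^+ S^z = S^+`. -/
lemma Sz_mul_Splus (m : ℕ) : Sz m * Splus m = Splus m * Sz m + Splus m := by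
  ext i j
  simp only [Sz, Matrix.add_apply, Matrix.diagonal_mul, Matrix.mul_diagonal, Splus,
    Matrix.of_apply]
  split_ifs with h
  · rw [← h]; push_cast; ring
  · ring

/-- `S^z S^- - S^- S^z = -S^-`. -/
lemma Sz_mul_Sminus (m : ℕ) : Sz m * Sminus m = Sminus m * Sz m - Sminus m := by
  have h := congrArg Matrix.transpose (Sz_mul_Splus m)
  have hz : (Sz m)ᵀ = Sz m := Matrix.diagonal_transpose _
  simp only [Matrix.transpose_mul, Matrix.transpose_add, hz] at h
  exact eq_sub_of_add_eq h.symm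

lemma Splus_mul_self_apply {m : ℕ} {i k : Fin (m + 1)} (h : (i : ℕ) + 1 = k) :
    Splus m i k * Splus m i k = ((i : ℂ) + 1) * (m - i) := by
  have hi : ((i : ℕ) : ℝ) ≤ m := by exact_mod_cast Nat.lt_succ_iff.mp i.isLt
  have hs : (0 : ℝ) ≤ ((i : ℕ) + 1) * (m - (i : ℕ)) :=
    mul_nonneg (by positivity) (sub_nonneg.mpr hi)
  simp only [Splus, Matrix.of_apply, if_pos h]
  rw [← Complex.ofReal_mul, Real.mul_self_sqrt hs]
  push_cast
  rfl

lemma Splus_mul_Sminus (m : ℕ) :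
    Splus m * Sminus m = Matrix.diagonal fun i : Fin (m + 1) => ((i : ℂ) + 1) * (m - i) := by
  ext i j
  rw [Matrix.mul_apply, Matrix.diagonal_apply]
  simp only [Sminus, Matrix.transpose_apply]
  split_ifs with hij
  · subst hij
    by_cases hi : (i : ℕ) + 1 < m + 1
    · rw [Finset.sum_eq_single ⟨(i : ℕ) + 1, hi⟩, Splus_mul_self_apply rfl]
      · intro k _ hk
        have : (i : ℕ) + 1 ≠ k := fun h => hk (Fin.ext h.symm)
        simp [Splus, this]
      · simp
    · have him : (i : ℕ) = m := by omega
      rw [him, sub_self, mul_zero]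
      refine Finset.sum_eq_zero fun k _ => ?_
      have : (i : ℕ) + 1 ≠ k := by omega
      simp [Splus, this]
  · refine Finset.sum_eq_zero fun k _ => ?_
    have : (i : ℕ) + 1 ≠ k ∨ (j : ℕ) + 1 ≠ k := by
      by_contra! h
      exact hij (Fin.ext (by omega))
    rcases this with h | h <;> simp [Splus, h]

lemma Sminus_mul_Splus (m : ℕ) :
    Sminus m * Splus m = Matrix.diagonal fun i : Fin (m + 1) => (i : ℂ) * (m - i + 1) := by
  ext i j
  rw [Matrix.mul_apply, Matrix.diagonal_apply]
  simp only [Sminus, Matrix.transpose_apply]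
  split_ifs with hij
  · subst hij
    by_cases hi : (i : ℕ) = 0
    · rw [hi, Nat.cast_zero, zero_mul]
      refine Finset.sum_eq_zero fun k _ => ?_
      have : (k : ℕ) + 1 ≠ i := by omega
      simp [Splus, this]
    · have hk' : (i : ℕ) - 1 + 1 = i := by omega
      rw [Finset.sum_eq_single ⟨(i : ℕ) - 1, by omega⟩, Splus_mul_self_apply hk']
      · have hc : (((i : ℕ) - 1 : ℕ) : ℂ) = (i : ℂ) - 1 := by
          rw [Nat.cast_sub (by omega), Nat.cast_one]
        rw [hc]
        ring
      · intro k _ hk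
        have : (k : ℕ) + 1 ≠ i := fun h => hk (Fin.ext (by simp only; omega))
        simp [Splus, this]
      · simp
  · refine Finset.sum_eq_zero fun k _ => ?_
    have : (k : ℕ) + 1 ≠ i ∨ (k : ℕ) + 1 ≠ j := by
      by_contra! h
      exact hij (Fin.ext (by omega))
    rcases this with h | h <;> simp [Splus, h]

/-- `S^+ S^- - S^- S^+ = 2 S^z`. -/
lemma Splus_mul_Sminus_eq (m : ℕ) :
    Splus m * Sminus m = Sminus m * Splus m + (2 : ℂ) • Sz m := by
  rw [Splus_mul_Sminus, Sminus_mul_Splus, Sz, ← Matrix.diagonal_smul, Matrix.diagonal_add]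
  congr 1
  ext i
  simp only [Pi.smul_apply, smul_eq_mul]
  ring

/-- The `gl(2)` generators `[[1/2 + S^z, S^-], [S^+, 1/2 - S^z]]` on the spin-`m/2` space. -/
def glGen (m : ℕ) : Fin 2 → Fin 2 → Matrix (Fin (m + 1)) (Fin (m + 1)) ℂ :=
  ![![(1 / 2 : ℂ) • 1 + Sz m, Sminus m], ![Splus m, (1 / 2 : ℂ) • 1 - Sz m]]

/-- `[E_ac, E_bd] = δ_ad E_bc - δ_bc E_ad`. -/
lemma glGen_comm (m : ℕ) (a b c d : Fin 2) :
    glGen m a c * glGen m b d = glGen m b d * glGen m a c +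
      ((if a = d then (1 : ℂ) else 0) • glGen m b c -
        (if b = c then (1 : ℂ) else 0) • glGen m a d) := by
  fin_cases a <;> fin_cases b <;> fin_cases c <;> fin_cases d <;>
    simp [glGen, add_mul, mul_add, sub_mul, mul_sub, Sz_mul_Splus, Sz_mul_Sminus,
      Splus_mul_Sminus_eq] <;>
    module

/-- The operator-valued entries `δ_ac λ + η E_ac` of the Lax operator. -/
def laxBlock (η : ℂ) (m : ℕ) (lam : ℂ) (a c : Fin 2) : Matrix (Fin (m + 1)) (Fin (m + 1)) ℂ :=
  (lam * if a = c then 1 else 0) • 1 + η • glGen m a c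

lemma Lax_apply (η : ℂ) (m : ℕ) (lam : ℂ) (a c : Fin 2) (i j : Fin (m + 1)) :
    Lax η m lam (a, i) (c, j) = laxBlock η m lam a c i j := by
  fin_cases a <;> fin_cases c <;> simp [Lax, laxBlock, glGen] <;> ring

lemma Rmat_apply (η ν : ℂ) (a b c d : Fin 2) :
    Rmat η ν (a, b) (c, d) =
      ν * (if a = c ∧ b = d then 1 else 0) + η * (if a = d ∧ b = c then 1 else 0) := by
  fin_cases a <;> fin_cases b <;> fin_cases c <;> fin_cases d <;> simp [Rmat]

lemma L13_mul_L23_apply (η : ℂ) (m : ℕ) (lam mu : ℂ) (a b c d : Fin 2) (i j : Fin (m + 1)) :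
    (L13 η m lam * L23 η m mu) (a, b, i) (c, d, j) =
      (laxBlock η m lam a c * laxBlock η m mu b d) i j := by
  simp [Matrix.mul_apply, Fintype.sum_prod_type, L13, L23, Lax_apply, -Fin.sum_univ_two,
    Finset.sum_ite_eq, ite_mul, mul_ite]

lemma L23_mul_L13_apply (η : ℂ) (m : ℕ) (lam mu : ℂ) (a b c d : Fin 2) (i j : Fin (m + 1)) :
    (L23 η m mu * L13 η m lam) (a, b, i) (c, d, j) =
      (laxBlock η m mu b d * laxBlock η m lam a c) i j := by
  simp [Matrix.mul_apply, Fintype.sum_prod_type, L13, L23, Lax_apply, -Fin.sum_univ_two,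
    Finset.sum_ite_eq, ite_mul, mul_ite]

lemma R12L_mul_apply (η ν : ℂ) (m : ℕ)
    (M : Matrix (Fin 2 × Fin 2 × Fin (m + 1)) (Fin 2 × Fin 2 × Fin (m + 1)) ℂ)
    (a b : Fin 2) (i : Fin (m + 1)) (q : Fin 2 × Fin 2 × Fin (m + 1)) :
    (R12L η ν m * M) (a, b, i) q = ν * M (a, b, i) q + η * M (b, a, i) q := by
  simp only [Matrix.mul_apply, Fintype.sum_prod_type, R12L, Rmat_apply, Matrix.of_apply]
  fin_cases a <;> fin_cases b <;> simp [add_mul, Finset.sum_add_distrib, add_comm]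

lemma mul_R12L_apply (η ν : ℂ) (m : ℕ)
    (M : Matrix (Fin 2 × Fin 2 × Fin (m + 1)) (Fin 2 × Fin 2 × Fin (m + 1)) ℂ)
    (c d : Fin 2) (j : Fin (m + 1)) (p : Fin 2 × Fin 2 × Fin (m + 1)) :
    (M * R12L η ν m) p (c, d, j) = ν * M p (c, d, j) + η * M p (d, c, j) := by
  simp only [Matrix.mul_apply, Fintype.sum_prod_type, R12L, Rmat_apply, Matrix.of_apply]
  fin_cases c <;> fin_cases d <;> simp [mul_add, Finset.sum_add_distrib, add_comm, mul_comm _ ν, mul_comm _ η]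

/-- The Yang–Baxter equation in terms of the operator-valued entries of the Lax operator. -/
lemma laxBlock_yang_baxter (η lam mu : ℂ) (m : ℕ) (a b c d : Fin 2) :
    (lam - mu) • (laxBlock η m lam a c * laxBlock η m mu b d) +
        η • (laxBlock η m lam b c * laxBlock η m mu a d) =
      (lam - mu) • (laxBlock η m mu b d * laxBlock η m lam a c) +
        η • (laxBlock η m mu b c * laxBlock η m lam a d) := by
  simp only [laxBlock, add_mul, mul_add, smul_mul_assoc, mul_smul_comm, one_mul, mul_one,
    glGen_comm m a b c d]
  module

/-- The Yang–Baxter equation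
`R₁₂(λ−μ) L₁₃(λ) L₂₃(μ) = L₂₃(μ) L₁₃(λ) R₁₂(λ−μ)` on `ℂ² ⊗ ℂ² ⊗ ℂ^{2s+1}`,
for every `η, λ, μ ∈ ℂ` and every spin `s` with `2s = m ∈ ℤ_{>0}`. -/
theorem lax_yang_baxter (η lam mu : ℂ) (m : ℕ) (hm : 1 ≤ m) :
    R12L η (lam - mu) m * L13 η m lam * L23 η m mu
      = L23 η m mu * L13 η m lam * R12L η (lam - mu) m := by
  ext ⟨a, b, i⟩ ⟨c, d, j⟩
  rw [Matrix.mul_assoc, R12L_mul_apply, mul_R12L_apply]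
  simp only [L13_mul_L23_apply, L23_mul_L13_apply]
  simpa only [Matrix.add_apply, Matrix.smul_apply, smul_eq_mul] using
    congrFun₂ (laxBlock_yang_baxter η lam mu m a b c d) i j
end AntiperiodicXXX
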